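/- Let T be a bounded self-adjoint positive operator on a Hilbert space, c ∈ (1,2], ζ > 0, and suppose H* = T^{(c−1)/2} G with ‖G‖ ≤ √ζ. Define the regularized approximation H_ξ = (T + ξ)⁻¹ T H* for ξ > 0. Then ‖√T (H_ξ − H*)‖² ≤ ζ ξ^c. -/

import Mathlib

theorem scalar_bound_16 (c ξ x : ℝ) (hc1 : 1 < c) (hc2 : c ≤ 2) (hξ : 0 < ξ) (hx : 0 ≤ x) :
    ‖Real.sqrt x * (((x + ξ)⁻¹ * x - 1) * x ^ ((c - 1) / 2))‖ ≤ ξ ^ (c / 2) := by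
  have hpos : 0 < x + ξ := by linarith
  have h1 : Real.sqrt x * (((x + ξ)⁻¹ * x - 1) * x ^ ((c - 1) / 2))
      = -(ξ * x ^ (c / 2) / (x + ξ)) := by
    have : x ^ (c / 2) = Real.sqrt x * x ^ ((c - 1) / 2) := by
      rw [Real.sqrt_eq_rpow, ← Real.rpow_add_of_nonneg hx (by norm_num) (by linarith)]
      congr 1; ring
    rw [this]; field_simp; ring
  rw [h1, norm_neg, Real.norm_of_nonneg (by positivity), div_le_iff₀ hpos]
  have h2 := Real.geom_mean_le_arith_mean2_weighted (w₁ := 1 - c / 2) (w₂ := c / 2)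
    (by linarith) (by linarith) hξ.le hx (by ring)
  have h3 : ξ = ξ ^ (c / 2) * ξ ^ (1 - c / 2) := by
    rw [← Real.rpow_add hξ]; simp
  have h4 : ξ ^ (1 - c / 2) * x ^ (c / 2) ≤ x + ξ := by nlinarith
  calc ξ * x ^ (c / 2) = ξ ^ (c / 2) * (ξ ^ (1 - c / 2) * x ^ (c / 2)) := by
        rw [← mul_assoc, ← h3]
    _ ≤ _ := by gcongr

set_option maxHeartbeats 1000000

theorem stmt_16 {H : Type*} [NormedAddCommGroup H] [InnerProductSpace ℂ H] [CompleteSpace H]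
    (T : H →L[ℂ] H) (hTsa : IsSelfAdjoint T)
    (hTpos : spectrum ℝ T ⊆ Set.Ici 0)  -- T is positive
    (c ζ : ℝ) (hc1 : 1 < c) (hc2 : c ≤ 2) (hζ : 0 < ζ)
    (G Hstar : H) (hG : ‖G‖ ≤ Real.sqrt ζ)
    (hHstar : Hstar = cfc (fun x : ℝ => x ^ ((c - 1) / 2)) T G)
    (ξ : ℝ) (hξ : 0 < ξ)
    (R : H →L[ℂ] H)
    (hR1 : (T + (ξ : ℂ) • (1 : H →L[ℂ] H)) ∘L R = 1)
    (hR2 : R ∘L (T + (ξ : ℂ) • (1 : H →L[ℂ] H)) = 1)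
    (Hξ : H) (hHξ : Hξ = R (T Hstar)) :
    ‖cfc Real.sqrt T (Hξ - Hstar)‖ ^ 2 ≤ ζ * ξ ^ c := by
  have hne : ∀ x ∈ spectrum ℝ T, x + ξ ≠ 0 := fun x hx => by
    have : 0 ≤ x := hTpos hx
    positivity
  have hci : ContinuousOn (fun x : ℝ => (x + ξ)⁻¹) (spectrum ℝ T) :=
    ContinuousOn.inv₀ (by fun_prop) hne
  have hcp : ContinuousOn (fun x : ℝ => x ^ ((c - 1) / 2)) (spectrum ℝ T) :=
    (Real.continuous_rpow_const (by linarith)).continuousOn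
  have hcs : ContinuousOn Real.sqrt (spectrum ℝ T) := Real.continuous_sqrt.continuousOn
  have hB : cfc (fun x : ℝ => x + ξ) T = T + (ξ : ℂ) • (1 : H →L[ℂ] H) := by
    rw [cfc_add_const ξ (fun x : ℝ => x) T (by fun_prop) hTsa, cfc_id' ℝ T hTsa, Algebra.algebraMap_eq_smul_one]
    congr 1
  have hBC : cfc (fun x : ℝ => x + ξ) T * cfc (fun x : ℝ => (x + ξ)⁻¹) T = 1 := by
    rw [← cfc_mul (fun x : ℝ => x + ξ) (fun x : ℝ => (x + ξ)⁻¹) T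
      (by fun_prop) hci, ← cfc_one ℝ T hTsa]
    exact cfc_congr fun x hx => mul_inv_cancel₀ (hne x hx)
  have hR : R = cfc (fun x : ℝ => (x + ξ)⁻¹) T := by
    have h2 : R * cfc (fun x : ℝ => x + ξ) T = 1 := by rw [hB]; exact hR2
    exact left_inv_eq_right_inv h2 hBC
  have hM : cfc Real.sqrt T * ((R * T - 1) * cfc (fun x : ℝ => x ^ ((c - 1) / 2)) T)
      = cfc (fun x : ℝ => Real.sqrt x * (((x + ξ)⁻¹ * x - 1) * x ^ ((c - 1) / 2))) T := by
    have hc3 : ContinuousOn (fun x : ℝ => (x + ξ)⁻¹ * x) (spectrum ℝ T) := hci.mul continuousOn_id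
    have hc4 : ContinuousOn (fun x : ℝ => (x + ξ)⁻¹ * x - 1) (spectrum ℝ T) :=
      hc3.sub continuousOn_const
    rw [cfc_mul Real.sqrt (fun x : ℝ => ((x + ξ)⁻¹ * x - 1) * x ^ ((c - 1) / 2)) T hcs
      (hc4.mul hcp), cfc_mul (fun x : ℝ => (x + ξ)⁻¹ * x - 1) _ T hc4 hcp,
      cfc_sub (fun x : ℝ => (x + ξ)⁻¹ * x) (fun _ => 1) T hc3 continuousOn_const,
      cfc_mul (fun x : ℝ => (x + ξ)⁻¹) (fun x => x) T hci continuousOn_id, cfc_id' ℝ T hTsa,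
      cfc_const_one ℝ T hTsa, hR]
  have hv : cfc Real.sqrt T (Hξ - Hstar) =
      (cfc Real.sqrt T * ((R * T - 1) * cfc (fun x : ℝ => x ^ ((c - 1) / 2)) T)) G := by
    rw [hHξ, hHstar]; rfl
  have hn : ‖cfc Real.sqrt T * ((R * T - 1) * cfc (fun x : ℝ => x ^ ((c - 1) / 2)) T)‖
      ≤ ξ ^ (c / 2) := by
    rw [hM]
    exact norm_cfc_le (by positivity) fun x hx => scalar_bound_16 c ξ x hc1 hc2 hξ (hTpos hx)
  have hfin : ‖cfc Real.sqrt T (Hξ - Hstar)‖ ≤ ξ ^ (c / 2) * Real.sqrt ζ := by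
    rw [hv]
    exact (ContinuousLinearMap.le_opNorm _ _).trans
      (mul_le_mul hn hG (norm_nonneg _) (by positivity))
  calc _ ≤ (ξ ^ (c / 2) * Real.sqrt ζ) ^ 2 := by gcongr
    _ = ζ * ξ ^ c := by
      rw [mul_pow, Real.sq_sqrt hζ.le, ← Real.rpow_natCast, ← Real.rpow_mul hξ.le, mul_comm]
      congr 2; push_cast; ring
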